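/- For all natural numbers k, p: for every j ≤ k the value 3^j * 2^(k+2-j) * p + 3^j * 2^(k+1-j) - 1 is odd, while for j = k + 1 the value equals 3^(k+1) * (2p + 1) - 1, which is even. Hence any odd number with pair (k, p) is converted to an even number by exactly k + 1 applications of T(x) = (3x + 1)/2. -/

import Mathlib

theorem collatz_shortcut_iterate (j a : ℕ) (ha : 0 < a) :
    (fun x : ℕ => (3 * x + 1) / 2)^[j] (2 ^ j * a - 1) = 3 ^ j * a - 1 := by
  induction j generalizing a with
  | zero => simp
  | succ j ih =>
    have hpos : 0 < 2 ^ j * a := by positivity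
    have step : (3 * (2 ^ (j + 1) * a - 1) + 1) / 2 = 2 ^ j * (3 * a) - 1 := by
      rw [show 2 ^ (j + 1) * a = 2 * (2 ^ j * a) by ring,
        show 2 ^ j * (3 * a) = 3 * (2 ^ j * a) by ring]
      omega
    rw [Function.iterate_succ_apply, step, ih (3 * a) (by positivity), pow_succ, mul_assoc]

theorem odd_two_mul_sub_one {b : ℕ} (hb : 0 < b) : Odd (2 * b - 1) :=
  ⟨b - 1, by omega⟩

theorem collatz_shortcut_parity (k p : ℕ) :
    (∀ j ≤ k, Odd (3 ^ j * 2 ^ (k + 2 - j) * p + 3 ^ j * 2 ^ (k + 1 - j) - 1)) ∧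
      3 ^ (k + 1) * 2 ^ (k + 2 - (k + 1)) * p + 3 ^ (k + 1) * 2 ^ (k + 1 - (k + 1)) - 1 =
        3 ^ (k + 1) * (2 * p + 1) - 1 ∧
      Even (3 ^ (k + 1) * (2 * p + 1) - 1) ∧
      (∀ j ≤ k,
        Odd ((fun x : ℕ => (3 * x + 1) / 2)^[j] (2 ^ (k + 2) * p + 2 ^ (k + 1) - 1))) ∧
      Even ((fun x : ℕ => (3 * x + 1) / 2)^[k + 1] (2 ^ (k + 2) * p + 2 ^ (k + 1) - 1)) := by
  have odd_value : ∀ j ≤ k,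
      Odd (3 ^ j * 2 ^ (k + 2 - j) * p + 3 ^ j * 2 ^ (k + 1 - j) - 1) := by
    intro j hj
    obtain ⟨m, rfl⟩ := Nat.exists_eq_add_of_le hj
    rw [show j + m + 2 - j = m + 2 by omega, show j + m + 1 - j = m + 1 by omega,
      show 3 ^ j * 2 ^ (m + 2) * p + 3 ^ j * 2 ^ (m + 1) =
        2 * (3 ^ j * 2 ^ m * (2 * p + 1)) by ring]
    exact odd_two_mul_sub_one (by positivity)
  have even_value : Even (3 ^ (k + 1) * (2 * p + 1) - 1) := by
    have hodd : Odd (3 ^ (k + 1) * (2 * p + 1)) :=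
      (Odd.pow (by decide)).mul (odd_two_mul_add_one p)
    exact hodd.tsub_odd odd_one
  refine ⟨odd_value, ?_, even_value, ?_, ?_⟩
  · rw [show k + 2 - (k + 1) = 1 by omega, Nat.sub_self]
    congr 1
    ring
  · intro j hj
    have hval := odd_value j hj
    obtain ⟨m, rfl⟩ := Nat.exists_eq_add_of_le hj
    rw [show j + m + 2 - j = m + 2 by omega, show j + m + 1 - j = m + 1 by omega] at hval
    rw [show 2 ^ (j + m + 2) * p + 2 ^ (j + m + 1) =
        2 ^ j * (2 ^ (m + 2) * p + 2 ^ (m + 1)) by ring,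
      collatz_shortcut_iterate _ _ (by positivity), mul_add, ← mul_assoc]
    exact hval
  · rw [show 2 ^ (k + 2) * p + 2 ^ (k + 1) = 2 ^ (k + 1) * (2 * p + 1) by ring,
      collatz_shortcut_iterate _ _ (by positivity)]
    exact even_value
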